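/- Let A be a Cohen–Macaulay local ring and let M and N be nonzero finitely generated Tor-independent A-modules. If M has reducible complexity and M is not maximal Cohen–Macaulay, then depth M + depth N = dim A + depth (M ⊗_A N). -/

import Mathlib

open IsLocalRing CategoryTheory

universe u

noncomputable section

/-! Basic commutative-algebra notions: depth, minimal free resolutions, Betti numbers,
complexity, syzygies, reducible complexity, upper reducing degree, Tor-independence,
Gorenstein dimension, CI-dimension, Cohen-Macaulay local rings. -/

/-- The depth of a module over a local ring: the supremum of lengths of regular
sequences on the module consisting of elements of the maximal ideal. -/
def moduleDepth (A : Type u) [CommRing A] [IsLocalRing A]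
    (M : Type u) [AddCommGroup M] [Module A M] : ℕ∞ :=
  sSup {n : ℕ∞ | ∃ rs : List A, (rs.length : ℕ∞) = n ∧
    (∀ x ∈ rs, x ∈ maximalIdeal A) ∧ RingTheory.Sequence.IsRegular M rs}

/-- A minimal free resolution of a module over a local ring. -/
structure MinFreeRes (A : Type u) [CommRing A] [IsLocalRing A]
    (M : Type u) [AddCommGroup M] [Module A M] : Type (u + 1) where
  F : ℕ → ModuleCat.{u} A
  free : ∀ n, Module.Free A (F n)
  fin : ∀ n, Module.Finite A (F n)
  d : ∀ n, F (n + 1) →ₗ[A] F n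
  aug : F 0 →ₗ[A] M
  aug_surj : Function.Surjective aug
  exact_aug : Function.Exact (d 0) aug
  exact_d : ∀ n, Function.Exact (d (n + 1)) (d n)
  minimal : ∀ n x, d n x ∈ (maximalIdeal A) • (⊤ : Submodule A (F n))

/-- The Betti numbers of a minimal free resolution. -/
def MinFreeRes.betti {A : Type u} [CommRing A] [IsLocalRing A]
    {M : Type u} [AddCommGroup M] [Module A M] (R : MinFreeRes A M) (n : ℕ) : ℕ :=
  Module.finrank A (R.F n)

/-- The sequence `β` is eventually bounded by `a * n ^ (t - 1)` for some real `a`. -/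
def CxBound (β : ℕ → ℕ) (t : ℕ) : Prop :=
  ∃ a : ℝ, ∃ N : ℕ, ∀ n, N ≤ n → (β n : ℝ) ≤ a * (n : ℝ) ^ ((t : ℝ) - 1)

/-- The complexity of a module: the least `t` such that the Betti sequence of a minimal
free resolution is eventually bounded by `a * n ^ (t - 1)` for some `a` (and `⊤` if no
such `t` exists). -/
def complexity (A : Type u) [CommRing A] [IsLocalRing A]
    (M : Type u) [AddCommGroup M] [Module A M] : ℕ∞ :=
  sInf {t : ℕ∞ | ∃ t' : ℕ, t = (t' : ℕ∞) ∧ ∃ R : MinFreeRes A M, CxBound R.betti t'}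

/-- A finite resolution of a module `M`:
an exact sequence `0 → G len → ⋯ → G 0 → M → 0`. -/
structure FinRes (A : Type u) [CommRing A]
    (M : Type u) [AddCommGroup M] [Module A M] : Type (u + 1) where
  len : ℕ
  G : ℕ → ModuleCat.{u} A
  d : ∀ n, G (n + 1) →ₗ[A] G n
  aug : G 0 →ₗ[A] M
  bounded : ∀ n, len < n → Subsingleton (G n)
  aug_surj : Function.Surjective aug
  exact_aug : Function.Exact (d 0) aug
  exact_d : ∀ n, Function.Exact (d (n + 1)) (d n)

/-- A module has finite projective dimension if it admits a finite resolution by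
projective modules. -/
def HasFiniteProjDim (A : Type u) [CommRing A]
    (M : Type u) [AddCommGroup M] [Module A M] : Prop :=
  ∃ R : FinRes A M, ∀ n, Module.Projective A (R.G n)

/-- `S` is an `n`-th syzygy of `M`: for `n = 0`, `S ≅ M`; for `n ≥ 1`, `S` is isomorphic to
the image of the `n`-th differential in a minimal free resolution of `M`. -/
def IsSyzygy (A : Type u) [CommRing A] [IsLocalRing A]
    (M : Type u) [AddCommGroup M] [Module A M]
    (S : Type u) [AddCommGroup S] [Module A S] : ℕ → Prop
  | 0 => Nonempty (S ≃ₗ[A] M)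
  | (n + 1) => ∃ R : MinFreeRes A M, Nonempty (S ≃ₗ[A] LinearMap.range (R.d n))

/-- `K` is obtained from `M` by a reduction of complexity coming from a cohomology class
of degree `t ≥ 1`, i.e. there is a short exact sequence `0 → M → K → Ω^{t-1}(M) → 0`. -/
def ReducesWithDeg (A : Type u) [CommRing A] [IsLocalRing A]
    (M K : ModuleCat.{u} A) (t : ℕ) : Prop :=
  1 ≤ t ∧ ∃ (S : Type u) (_ : AddCommGroup S) (_ : Module A S),
    IsSyzygy A M S (t - 1) ∧
    ∃ (f : M →ₗ[A] K) (g : K →ₗ[A] S),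
      Function.Injective f ∧ Function.Surjective g ∧ Function.Exact f g

/-- The class of (bundled) modules having reducible complexity: the smallest class
containing all modules of finite projective dimension, and containing every module `M` of
finite positive complexity admitting a short exact sequence
`0 → M → K → Ω^{t-1}(M) → 0` (coming from a degree-`t` self-extension) with
`cx K < cx M` and `K` of reducible complexity. -/
inductive HasRedCxCat (A : Type u) [CommRing A] [IsLocalRing A] : ModuleCat.{u} A → Prop
  | of_finite_pd (M : ModuleCat.{u} A) : HasFiniteProjDim A M → HasRedCxCat A M
  | of_step (M K : ModuleCat.{u} A) (t : ℕ) :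
      complexity A M ≠ 0 → complexity A M ≠ ⊤ →
      ReducesWithDeg A M K t →
      complexity A K < complexity A M →
      HasRedCxCat A K → HasRedCxCat A M

/-- A module has reducible complexity. -/
def HasReducibleComplexity (A : Type u) [CommRing A] [IsLocalRing A]
    (M : Type u) [AddCommGroup M] [Module A M] : Prop :=
  HasRedCxCat A (ModuleCat.of A M)

/-- A sequence of short exact sequences `0 → K_{i-1} → K_i → Ω^{d_i - 1}(K_{i-1}) → 0`
with strictly decreasing complexities, ending in a module of complexity zero, i.e. a
sequence reducing the complexity of `Ks 0`. -/
def IsReducingSeq (A : Type u) [CommRing A] [IsLocalRing A] (t : ℕ)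
    (Ks : Fin (t + 1) → ModuleCat.{u} A) (degs : Fin t → ℕ) : Prop :=
  (∀ i : Fin t, ReducesWithDeg A (Ks i.castSucc) (Ks i.succ) (degs i)) ∧
  (∀ i : Fin t, complexity A (Ks i.succ) < complexity A (Ks i.castSucc)) ∧
  complexity A (Ks (Fin.last t)) = 0

open Classical in
/-- The upper reducing degree of `M`: `⊤` if `M` has finite projective dimension, and
otherwise the supremum, over all sequences reducing the complexity of `M`, of the minimum
of the degrees of the cohomology classes involved. -/
def upperReducingDegree (A : Type u) [CommRing A] [IsLocalRing A]
    (M : Type u) [AddCommGroup M] [Module A M] : ℕ∞ :=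
  if HasFiniteProjDim A M then ⊤
  else sSup {r : ℕ∞ | ∃ (t : ℕ) (Ks : Fin (t + 1) → ModuleCat.{u} A) (degs : Fin t → ℕ),
    Ks 0 = ModuleCat.of A M ∧ IsReducingSeq A t Ks degs ∧
    r = ⨅ i : Fin t, (degs i : ℕ∞)}

/-- The `n`-th Tor module of two modules. -/
def torModule (A : Type u) [CommRing A] (M N : Type u)
    [AddCommGroup M] [Module A M] [AddCommGroup N] [Module A N] (n : ℕ) : ModuleCat.{u} A :=
  ((Tor (ModuleCat.{u} A) n).obj (ModuleCat.of A M)).obj (ModuleCat.of A N)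

/-- Two modules are Tor-independent if `Tor_n(M, N) = 0` for all `n > 0`. -/
def TorIndep (A : Type u) [CommRing A] (M N : Type u)
    [AddCommGroup M] [Module A M] [AddCommGroup N] [Module A N] : Prop :=
  ∀ n : ℕ, 0 < n → Subsingleton (torModule A M N n)

/-- The `n`-th Ext module of two modules. -/
def extModule (A : Type u) [CommRing A] (M N : Type u)
    [AddCommGroup M] [Module A M] [AddCommGroup N] [Module A N] (n : ℕ) : ModuleCat.{u} A :=
  ((Ext A (ModuleCat.{u} A) n).obj (Opposite.op (ModuleCat.of A M))).obj (ModuleCat.of A N)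

/-- A module `G` has Gorenstein dimension zero if it is reflexive and
`Ext^n(G, A) = 0 = Ext^n(Hom(G, A), A)` for all `n > 0`. -/
def GDimZero (A : Type u) [CommRing A] (G : Type u) [AddCommGroup G] [Module A G] : Prop :=
  Module.IsReflexive A G ∧
  ∀ n : ℕ, 0 < n →
    Subsingleton (extModule A G A n) ∧ Subsingleton (extModule A (Module.Dual A G) A n)

/-- A module has finite Gorenstein dimension if it admits a finite resolution by modules
of Gorenstein dimension zero. -/
def HasFiniteGDim (A : Type u) [CommRing A]
    (M : Type u) [AddCommGroup M] [Module A M] : Prop :=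
  ∃ R : FinRes A M, ∀ n, GDimZero A (R.G n)

/-- The Krull dimension of a ring, viewed in `WithBot ℕ∞`. -/
def ringKrullDimE (A : Type u) [CommRing A] : WithBot ℕ∞ := ringKrullDim A

/-- A local ring is Cohen-Macaulay if its depth equals its Krull dimension. -/
def IsCMLocalRing (A : Type u) [CommRing A] [IsLocalRing A] : Prop :=
  (moduleDepth A A : WithBot ℕ∞) = ringKrullDimE A

/-- A module over a local ring is maximal Cohen-Macaulay if its depth equals the Krull
dimension of the ring. -/
def IsMaxCM (A : Type u) [CommRing A] [IsLocalRing A]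
    (M : Type u) [AddCommGroup M] [Module A M] : Prop :=
  (moduleDepth A M : WithBot ℕ∞) = ringKrullDimE A

/-- A local ring is Gorenstein if and only if every finitely generated module over it has
finite Gorenstein dimension. -/
def IsGorensteinLocalRing (A : Type u) [CommRing A] [IsLocalRing A] : Prop :=
  ∀ M : ModuleCat.{u} A, Module.Finite A M → HasFiniteGDim A M

/-- A module `M` over a local ring `A` has finite CI-dimension if there is a diagram of
local ring homomorphisms `A → R ← Q` with `A → R` flat and `Q → R` surjective with kernel
generated by a regular sequence, such that `R ⊗_A M` has finite projective dimension
over `Q`. -/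
def HasFiniteCIDimMod (A : Type u) [CommRing A] [IsLocalRing A]
    (M : Type u) [AddCommGroup M] [Module A M] : Prop :=
  ∃ (R Q : Type u) (_ : CommRing R) (_ : CommRing Q) (_ : IsLocalRing R) (_ : IsLocalRing Q)
    (f : A →+* R) (g : Q →+* R),
    IsLocalHom f ∧ IsLocalHom g ∧ Function.Surjective g ∧
    (∃ rs : List Q, RingTheory.Sequence.IsRegular Q rs ∧
      RingHom.ker g = Ideal.span {x | x ∈ rs}) ∧
    (letI : Algebra A R := f.toAlgebra
     Module.Flat A R ∧
     (letI : Module Q (TensorProduct A R M) := Module.compHom _ g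
      HasFiniteProjDim Q (TensorProduct A R M)))

/-- Vanishing of `Ext^i(k, M)` for the residue field `k`. -/
def ExtVanishes (A : Type u) [CommRing A] [IsLocalRing A]
    (M : Type u) [AddCommGroup M] [Module A M] (i : ℕ) : Prop :=
  Subsingleton (Abelian.Ext (ModuleCat.of A (A ⧸ maximalIdeal A)) (ModuleCat.of A M) i)

/-- `n` is the least index `i` with `Ext^i(k, M) ≠ 0`. -/
def HasExtDepth (A : Type u) [CommRing A] [IsLocalRing A]
    (M : Type u) [AddCommGroup M] [Module A M] (n : ℕ) : Prop :=
  (∀ i < n, ExtVanishes A M i) ∧ ¬ ExtVanishes A M n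

section ResidueExt

variable {A : Type u} [CommRing A] [IsLocalRing A]
  {X Y Z : Type u} [AddCommGroup X] [Module A X] [AddCommGroup Y] [Module A Y]
  [AddCommGroup Z] [Module A Z]

lemma HasExtDepth.le_of_forall_lt {n m : ℕ} (h : HasExtDepth A X n)
    (hm : ∀ i < m, ExtVanishes A X i) : m ≤ n := by
  by_contra! hlt
  exact h.2 (hm n hlt)

lemma HasExtDepth.unique {n m : ℕ} (h : HasExtDepth A X n) (hm : HasExtDepth A X m) : n = m :=
  le_antisymm (hm.le_of_forall_lt h.1) (h.le_of_forall_lt hm.1)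

/-- The map induced by a linear map on `Ext(k, -)`, as an additive function of the linear map. -/
def residueExtMap {i : ℕ}
    (x : Abelian.Ext (ModuleCat.of A (A ⧸ maximalIdeal A)) (ModuleCat.of A X) i) :
    (X →ₗ[A] Y) →+
      Abelian.Ext (ModuleCat.of A (A ⧸ maximalIdeal A)) (ModuleCat.of A Y) i where
  toFun f := x.comp (Abelian.Ext.mk₀ (ModuleCat.ofHom f)) (add_zero i)
  map_zero' := by simp
  map_add' f g := by rw [ModuleCat.ofHom_add, Abelian.Ext.mk₀_add, Abelian.Ext.comp_add]

lemma residueExtMap_id {i : ℕ}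
    (x : Abelian.Ext (ModuleCat.of A (A ⧸ maximalIdeal A)) (ModuleCat.of A X) i) :
    residueExtMap x (LinearMap.id : X →ₗ[A] X) = x := by
  simp [residueExtMap]

lemma residueExtMap_comp {i : ℕ}
    (x : Abelian.Ext (ModuleCat.of A (A ⧸ maximalIdeal A)) (ModuleCat.of A X) i)
    (f : X →ₗ[A] Y) (g : Y →ₗ[A] Z) :
    residueExtMap x (g ∘ₗ f) = residueExtMap (residueExtMap x f) g := by
  simp [residueExtMap]

lemma residueExtMap_smul_of_mem {i : ℕ}
    (x : Abelian.Ext (ModuleCat.of A (A ⧸ maximalIdeal A)) (ModuleCat.of A X) i)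
    {a : A} (ha : a ∈ maximalIdeal A) (f : X →ₗ[A] Y) :
    residueExtMap x (a • f) = 0 := by
  have h : residueExtMap x (a • (LinearMap.id : X →ₗ[A] X)) = 0 := by
    have hmem : a ∈ Module.annihilator A (ModuleCat.of A (A ⧸ maximalIdeal A)) := by
      change a ∈ Module.annihilator A (A ⧸ maximalIdeal A)
      rwa [Ideal.annihilator_quotient]
    have := Abelian.Ext.postcomp_smul_id_eq_zero_of_mem_annihilator
      (M := ModuleCat.of A X) hmem i
    exact DFunLike.congr_fun (congrArg AddCommGrpCat.Hom.hom this) x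
  have hf : a • f = f ∘ₗ (a • (LinearMap.id : X →ₗ[A] X)) := by
    ext; simp
  rw [hf, residueExtMap_comp, h]
  simp [residueExtMap]

/-- If the identity of `Y` is a finite sum of maps factoring through `X`, then vanishing of
`Ext(k, -)` passes from `X` to `Y`. -/
lemma ExtVanishes.of_id_eq_sum {ι : Type*} {s : Finset ι} {f : ι → X →ₗ[A] Y}
    {g : ι → Y →ₗ[A] X} (h : ∑ j ∈ s, f j ∘ₗ g j = LinearMap.id) {i : ℕ}
    (hX : ExtVanishes A X i) : ExtVanishes A Y i := by
  have := hX
  unfold ExtVanishes at this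
  refine subsingleton_of_forall_eq 0 fun y ↦ ?_
  rw [← residueExtMap_id y, ← h, map_sum]
  refine Finset.sum_eq_zero fun j _ ↦ ?_
  rw [residueExtMap_comp, Subsingleton.elim (residueExtMap y (g j)) 0]
  simp [residueExtMap]

lemma ExtVanishes.of_comp_eq_id {f : X →ₗ[A] Y} {g : Y →ₗ[A] X} (h : f ∘ₗ g = LinearMap.id)
    {i : ℕ} (hX : ExtVanishes A X i) : ExtVanishes A Y i :=
  hX.of_id_eq_sum (s := {()}) (f := fun _ ↦ f) (g := fun _ ↦ g) (by simpa using h)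

lemma ExtVanishes.of_equiv (e : X ≃ₗ[A] Y) {i : ℕ} (hX : ExtVanishes A X i) :
    ExtVanishes A Y i :=
  hX.of_comp_eq_id (f := e.toLinearMap) (g := e.symm.toLinearMap) (by simp)

lemma HasExtDepth.of_equiv (e : X ≃ₗ[A] Y) {n : ℕ} (h : HasExtDepth A X n) :
    HasExtDepth A Y n :=
  ⟨fun i hi ↦ (h.1 i hi).of_equiv e, fun h' ↦ h.2 (h'.of_equiv e.symm)⟩

/-- The short complex of modules attached to an exact pair of linear maps. -/
abbrev exactShortComplex (f : X →ₗ[A] Y) (g : Y →ₗ[A] Z) (h : Function.Exact f g) :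
    ShortComplex (ModuleCat.{u} A) :=
  ModuleCat.shortComplexOfCompEqZero f g h.linearMap_comp_eq_zero

omit [IsLocalRing A] in
lemma exactShortComplex_shortExact {f : X →ₗ[A] Y} {g : Y →ₗ[A] Z}
    (hf : Function.Injective f) (hg : Function.Surjective g) (h : Function.Exact f g) :
    (exactShortComplex f g h).ShortExact where
  exact := ModuleCat.shortComplex_exact _ h
  mono_f := (ModuleCat.mono_iff_injective _).mpr hf
  epi_g := (ModuleCat.epi_iff_surjective _).mpr hg

variable {f : X →ₗ[A] Y} {g : Y →ₗ[A] Z} (hf : Function.Injective f)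
  (hg : Function.Surjective g) (h : Function.Exact f g)

include hf hg h

lemma ExtVanishes.middle {i : ℕ} (hX : ExtVanishes A X i) (hZ : ExtVanishes A Z i) :
    ExtVanishes A Y i := by
  unfold ExtVanishes at hX hZ
  refine subsingleton_of_forall_eq 0 fun y ↦ ?_
  obtain ⟨x, rfl⟩ := Abelian.Ext.covariant_sequence_exact₂ _
    (exactShortComplex_shortExact hf hg h) y (hZ.elim _ _)
  rw [hX.elim x 0]
  simp

lemma ExtVanishes.left {i : ℕ} (hY : ExtVanishes A Y (i + 1)) (hZ : ExtVanishes A Z i) :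
    ExtVanishes A X (i + 1) := by
  unfold ExtVanishes at hY hZ
  refine subsingleton_of_forall_eq 0 fun x ↦ ?_
  obtain ⟨z, rfl⟩ := Abelian.Ext.covariant_sequence_exact₁ _
    (exactShortComplex_shortExact hf hg h) x (hY.elim _ _) rfl
  rw [hZ.elim z 0]
  simp

lemma ExtVanishes.right {i : ℕ} (hX : ExtVanishes A X (i + 1)) (hY : ExtVanishes A Y i) :
    ExtVanishes A Z i := by
  unfold ExtVanishes at hX hY
  refine subsingleton_of_forall_eq 0 fun z ↦ ?_
  obtain ⟨y, rfl⟩ := Abelian.Ext.covariant_sequence_exact₃ _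
    (exactShortComplex_shortExact hf hg h) z rfl (hX.elim _ _)
  rw [hY.elim y 0]
  simp

/-- If `X → Y` induces zero on `Ext^{i+1}(k, -)`, then `Ext^i(k, Z) = 0` forces
`Ext^{i+1}(k, X) = 0`. -/
lemma ExtVanishes.left_of_map_eq_zero {i : ℕ}
    (h0 : ∀ x : Abelian.Ext (ModuleCat.of A (A ⧸ maximalIdeal A)) (ModuleCat.of A X) (i + 1),
      residueExtMap x f = 0)
    (hZ : ExtVanishes A Z i) : ExtVanishes A X (i + 1) := by
  unfold ExtVanishes at hZ
  refine subsingleton_of_forall_eq 0 fun x ↦ ?_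
  obtain ⟨z, rfl⟩ := Abelian.Ext.covariant_sequence_exact₁ _
    (exactShortComplex_shortExact hf hg h) x (h0 x) rfl
  rw [hZ.elim z 0]
  simp

omit hg h

lemma ExtVanishes.zero_of_map_eq_zero
    (h0 : ∀ x : Abelian.Ext (ModuleCat.of A (A ⧸ maximalIdeal A)) (ModuleCat.of A X) 0,
      residueExtMap x f = 0) : ExtVanishes A X 0 := by
  have : Mono (ModuleCat.ofHom f) := (ModuleCat.mono_iff_injective _).mpr hf
  refine subsingleton_of_forall_eq 0 fun x ↦ ?_
  refine Abelian.Ext.postcomp_mk₀_injective_of_mono _ (ModuleCat.ofHom f) ?_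
  rw [map_zero]
  exact h0 x

lemma ExtVanishes.zero_of_injective (hY : ExtVanishes A Y 0) : ExtVanishes A X 0 := by
  unfold ExtVanishes at hY
  exact ExtVanishes.zero_of_map_eq_zero hf fun _ ↦ hY.elim _ _

end ResidueExt

section Depth

variable {A : Type u} [CommRing A] [IsLocalRing A] [IsNoetherianRing A]

/-- Rees' theorem over a local ring. -/
lemma forall_extVanishes_iff_exists_isRegular (M : Type u) [AddCommGroup M] [Module A M]
    [Module.Finite A M] [Nontrivial M] (n : ℕ) :
    (∀ i < n, ExtVanishes A M i) ↔
      ∃ rs : List A, rs.length = n ∧ (∀ r ∈ rs, r ∈ maximalIdeal A) ∧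
        RingTheory.Sequence.IsRegular M rs := by
  have hlt : maximalIdeal A • (⊤ : Submodule A (ModuleCat.of A M)) < ⊤ :=
    (Submodule.top_ne_ideal_smul_of_le_jacobson_annihilator
      (IsLocalRing.maximalIdeal_le_jacobson _)).symm.lt_top
  have hsupp : Module.support A (ModuleCat.of A (A ⧸ maximalIdeal A)) =
      PrimeSpectrum.zeroLocus (maximalIdeal A : Set A) := by
    change Module.support A (A ⧸ maximalIdeal A) = _
    rw [Module.support_eq_zeroLocus, Ideal.annihilator_quotient]
  have hfin : Module.Finite A (ModuleCat.of A (A ⧸ maximalIdeal A)) :=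
    inferInstanceAs (Module.Finite A (A ⧸ maximalIdeal A))
  constructor
  · intro h
    exact ModuleCat.exists_isRegular_of_exists_subsingleton_ext (maximalIdeal A) n
      (ModuleCat.of A M) hlt _ hsupp h
  · rintro ⟨rs, rfl, hrs, hreg⟩
    exact ModuleCat.subsingleton_ext_of_exists_isRegular (maximalIdeal A) _ hsupp.subset
      (ModuleCat.of A M) hlt rs hrs hreg

lemma length_le_ringKrullDim_of_isRegular (M : Type u) [AddCommGroup M] [Module A M]
    [Module.Finite A M] {rs : List A} (hreg : RingTheory.Sequence.IsRegular M rs) :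
    (rs.length : WithBot ℕ∞) ≤ ringKrullDim A := by
  have : Nontrivial (M ⧸ Ideal.ofList rs • (⊤ : Submodule A M)) :=
    Submodule.Quotient.nontrivial_iff.mpr hreg.top_ne_smul.symm
  calc (rs.length : WithBot ℕ∞)
      ≤ Module.supportDim A (M ⧸ Ideal.ofList rs • (⊤ : Submodule A M)) + rs.length :=
        le_add_of_nonneg_left (Order.krullDim_nonneg_iff.mpr
          (Module.nonempty_support_iff.mpr inferInstance).to_subtype)
    _ = Module.supportDim A M := Module.supportDim_add_length_eq_supportDim_of_isRegular rs hreg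
    _ ≤ ringKrullDim A := Module.supportDim_le_ringKrullDim A M

/-- The depth of a nonzero finite module is a natural number bounded by the dimension of the
ring, and it is detected by `Ext(k, -)`. -/
lemma exists_moduleDepth_eq (M : Type u) [AddCommGroup M] [Module A M]
    [Module.Finite A M] [Nontrivial M] :
    ∃ n : ℕ, moduleDepth A M = n ∧ HasExtDepth A M n ∧ (n : WithBot ℕ∞) ≤ ringKrullDim A := by
  classical
  have hbdd : ∃ i, ¬ ExtVanishes A M i := by
    by_contra! hall
    obtain ⟨d, hd⟩ : ∃ d : ℕ, ringKrullDim A = d := by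
      have h1 := ringKrullDim_ne_top (R := A)
      have h2 := ringKrullDim_ne_bot (R := A)
      generalize ringKrullDim A = k at h1 h2
      lift k to ℕ∞ using h2
      lift k to ℕ using fun hk ↦ h1 (by rw [hk]; rfl)
      exact ⟨k, rfl⟩
    obtain ⟨rs, hlen, -, hreg⟩ :=
      (forall_extVanishes_iff_exists_isRegular M (d + 1)).mp fun i _ ↦ hall i
    have := (length_le_ringKrullDim_of_isRegular M hreg).trans_eq hd
    rw [hlen] at this
    norm_cast at this
    omega
  have hdepth : HasExtDepth A M (Nat.find hbdd) :=
    ⟨fun i hi ↦ not_not.mp (Nat.find_min hbdd hi), Nat.find_spec hbdd⟩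
  obtain ⟨rs, hlen, hrs, hreg⟩ :=
    (forall_extVanishes_iff_exists_isRegular M _).mp hdepth.1
  refine ⟨Nat.find hbdd, le_antisymm ?_ ?_, hdepth,
    hlen ▸ length_le_ringKrullDim_of_isRegular M hreg⟩
  · refine sSup_le ?_
    rintro _ ⟨rs', rfl, hrs', hreg'⟩
    exact_mod_cast hdepth.le_of_forall_lt
      ((forall_extVanishes_iff_exists_isRegular M _).mpr ⟨rs', rfl, hrs', hreg'⟩)
  · exact le_sSup ⟨rs, by rw [hlen], hrs, hreg⟩

end Depth

section TorIndep

variable {A : Type u} [CommRing A]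

/-- Tor-independence in terms of a projective resolution of the second module. -/
lemma torIndep_iff_exact {M N : Type u} [AddCommGroup M] [Module A M] [AddCommGroup N]
    [Module A N] (P : ProjectiveResolution (ModuleCat.of A N)) :
    TorIndep A M N ↔ ∀ n, Function.Exact (LinearMap.lTensor M (P.complex.d (n + 2) (n + 1)).hom)
      (LinearMap.lTensor M (P.complex.d (n + 1) n).hom) := by
  have key (n : ℕ) : Subsingleton (torModule A M N (n + 1)) ↔
      Function.Exact (LinearMap.lTensor M (P.complex.d (n + 2) (n + 1)).hom)
        (LinearMap.lTensor M (P.complex.d (n + 1) n).hom) := by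
    let F := (MonoidalCategory.tensoringLeft (ModuleCat.{u} A)).obj (ModuleCat.of A M)
    let K := (F.mapHomologicalComplex (ComplexShape.down ℕ)).obj P.complex
    rw [← ModuleCat.isZero_iff_subsingleton]
    have e : torModule A M N (n + 1) ≅ K.homology (n + 1) := P.isoLeftDerivedObj F (n + 1)
    rw [e.isZero_iff, ← HomologicalComplex.exactAt_iff_isZero_homology,
      HomologicalComplex.exactAt_iff' K (n + 2) (n + 1) n
        (by simp only [ChainComplex.prev]; rfl) (by simp),
      ShortComplex.ShortExact.moduleCat_exact_iff_function_exact]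
    rfl
  constructor
  · exact fun h n ↦ (key n).mp (h (n + 1) n.succ_pos)
  · rintro h (_ | n) hn
    · omega
    · exact (key n).mpr (h n)

lemma projectiveResolution_exact {N : Type u} [AddCommGroup N] [Module A N]
    (P : ProjectiveResolution (ModuleCat.of A N)) (n : ℕ) :
    Function.Exact (P.complex.d (n + 2) (n + 1)).hom (P.complex.d (n + 1) n).hom :=
  (ShortComplex.ShortExact.moduleCat_exact_iff_function_exact _).mp (P.exact_succ n)

lemma projectiveResolution_flat {N : Type u} [AddCommGroup N] [Module A N]
    (P : ProjectiveResolution (ModuleCat.of A N)) (n : ℕ) :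
    Module.Flat A (P.complex.X n) := by
  have : Module.Projective A (P.complex.X n) :=
    (IsProjective.iff_projective _).mpr (P.projective n)
  infer_instance

lemma torIndep_of_flat (M N : Type u) [AddCommGroup M] [Module A M] [AddCommGroup N]
    [Module A N] [Module.Flat A M] : TorIndep A M N :=
  let P := projectiveResolution (ModuleCat.of A N)
  (torIndep_iff_exact P).mpr fun n ↦
    Module.Flat.lTensor_exact M (projectiveResolution_exact P n)

lemma torIndep_of_projective_right (M N : Type u) [AddCommGroup M] [Module A M] [AddCommGroup N]
    [Module A N] [Module.Projective A N] : TorIndep A M N := by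
  rintro (_ | n) hn
  · omega
  · have : Projective (ModuleCat.of A N) := (IsProjective.iff_projective _).mp ‹_›
    exact ModuleCat.isZero_iff_subsingleton.mp (isZero_Tor_succ_of_projective _ _ _ n)

variable {X Y Z N : Type u} [AddCommGroup X] [Module A X] [AddCommGroup Y] [Module A Y]
  [AddCommGroup Z] [Module A Z] [AddCommGroup N] [Module A N]
  {f : X →ₗ[A] Y} {g : Y →ₗ[A] Z}

lemma rTensor_lTensor_apply {P Q : Type u} [AddCommGroup P] [Module A P] [AddCommGroup Q]
    [Module A Q] (f : X →ₗ[A] Y) (d : P →ₗ[A] Q) (x : TensorProduct A X P) :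
    LinearMap.rTensor Q f (LinearMap.lTensor X d x) =
      LinearMap.lTensor Y d (LinearMap.rTensor P f x) := by
  rw [← LinearMap.comp_apply, ← LinearMap.comp_apply, LinearMap.rTensor_comp_lTensor,
    LinearMap.lTensor_comp_rTensor]

lemma TorIndep.middle (hg : Function.Surjective g) (h : Function.Exact f g)
    (hf : Function.Injective f) (hX : TorIndep A X N) (hZ : TorIndep A Z N) :
    TorIndep A Y N := by
  let P := projectiveResolution (ModuleCat.of A N)
  rw [torIndep_iff_exact P] at hX hZ ⊢
  intro n y
  refine ⟨fun hy ↦ ?_, ?_⟩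
  · have := projectiveResolution_flat P
    have hz := hZ n (LinearMap.rTensor _ g y)
    rw [← rTensor_lTensor_apply, hy, map_zero] at hz
    obtain ⟨z, hz⟩ := hz.mp rfl
    obtain ⟨y', rfl⟩ := LinearMap.rTensor_surjective _ hg z
    rw [← rTensor_lTensor_apply, ← sub_eq_zero, ← map_sub] at hz
    obtain ⟨x, hx⟩ := (rTensor_exact _ h hg _).mp hz
    have hdx := hX n x
    have hdx0 : LinearMap.lTensor X (P.complex.d (n + 1) n).hom x = 0 := by
      refine Module.Flat.rTensor_preserves_injective_linearMap f hf ?_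
      rw [rTensor_lTensor_apply, hx, map_sub, hy, ← LinearMap.comp_apply,
        ← LinearMap.lTensor_comp, (projectiveResolution_exact P n).linearMap_comp_eq_zero]
      simp
    obtain ⟨x', rfl⟩ := hdx.mp hdx0
    refine ⟨y' - LinearMap.rTensor _ f x', ?_⟩
    rw [map_sub, ← rTensor_lTensor_apply, hx]
    abel
  · rintro ⟨y, rfl⟩
    rw [← LinearMap.comp_apply,
        ← LinearMap.lTensor_comp, (projectiveResolution_exact P n).linearMap_comp_eq_zero]
    simp

lemma TorIndep.left (hg : Function.Surjective g) (h : Function.Exact f g)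
    (hf : Function.Injective f) (hY : TorIndep A Y N) (hZ : TorIndep A Z N) :
    TorIndep A X N := by
  let P := projectiveResolution (ModuleCat.of A N)
  rw [torIndep_iff_exact P] at hY hZ ⊢
  intro n x
  refine ⟨fun hx ↦ ?_, ?_⟩
  · have := projectiveResolution_flat P
    have hy := hY n (LinearMap.rTensor _ f x)
    rw [← rTensor_lTensor_apply, hx, map_zero] at hy
    obtain ⟨y, hy⟩ := hy.mp rfl
    have hz := hZ (n + 1) (LinearMap.rTensor _ g y)
    rw [← rTensor_lTensor_apply, hy, ← LinearMap.comp_apply, ← LinearMap.rTensor_comp,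
      h.linearMap_comp_eq_zero, LinearMap.rTensor_zero, LinearMap.zero_apply] at hz
    obtain ⟨z, hz⟩ := hz.mp rfl
    obtain ⟨y', rfl⟩ := LinearMap.rTensor_surjective _ hg z
    rw [← rTensor_lTensor_apply, ← sub_eq_zero, ← map_sub] at hz
    obtain ⟨x', hx'⟩ := (rTensor_exact _ h hg _).mp hz
    refine ⟨-x', Module.Flat.rTensor_preserves_injective_linearMap f hf ?_⟩
    rw [map_neg, map_neg, rTensor_lTensor_apply, hx', map_sub, hy, ← LinearMap.comp_apply,
      ← LinearMap.lTensor_comp, (projectiveResolution_exact P (n + 1)).linearMap_comp_eq_zero]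
    simp
  · rintro ⟨x, rfl⟩
    rw [← LinearMap.comp_apply,
        ← LinearMap.lTensor_comp, (projectiveResolution_exact P n).linearMap_comp_eq_zero]
    simp

lemma TorIndep.rTensor_injective (hg : Function.Surjective g) (h : Function.Exact f g)
    (hf : Function.Injective f) (hZ : TorIndep A Z N) :
    Function.Injective (LinearMap.rTensor N f) := by
  let P := projectiveResolution (ModuleCat.of A N)
  rw [torIndep_iff_exact P] at hZ
  have := projectiveResolution_flat P
  let π : P.complex.X 0 →ₗ[A] N := (P.π.f 0).hom
  have hπ : Function.Surjective π := (ModuleCat.epi_iff_surjective (P.π.f 0)).mp inferInstance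
  have hexact : Function.Exact (P.complex.d 1 0).hom π :=
    (ShortComplex.ShortExact.moduleCat_exact_iff_function_exact _).mp P.exact₀
  rw [injective_iff_map_eq_zero]
  intro x hx
  obtain ⟨x, rfl⟩ := LinearMap.lTensor_surjective _ hπ x
  rw [rTensor_lTensor_apply] at hx
  obtain ⟨y, hy⟩ := (lTensor_exact _ hexact hπ _).mp hx
  have hz := hZ 0 (LinearMap.rTensor _ g y)
  rw [← rTensor_lTensor_apply, hy, ← LinearMap.comp_apply, ← LinearMap.rTensor_comp,
      h.linearMap_comp_eq_zero, LinearMap.rTensor_zero, LinearMap.zero_apply] at hz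
  obtain ⟨z, hz⟩ := hz.mp rfl
  obtain ⟨y', rfl⟩ := LinearMap.rTensor_surjective _ hg z
  rw [← rTensor_lTensor_apply, ← sub_eq_zero, ← map_sub] at hz
  obtain ⟨x', hx'⟩ := (rTensor_exact _ h hg _).mp hz
  have hxx : x = -LinearMap.lTensor X (P.complex.d 1 0).hom x' := by
    refine Module.Flat.rTensor_preserves_injective_linearMap f hf ?_
    rw [map_neg, rTensor_lTensor_apply, hx', map_sub, hy, ← LinearMap.comp_apply,
      ← LinearMap.lTensor_comp, (projectiveResolution_exact P 0).linearMap_comp_eq_zero]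
    simp
  rw [hxx, map_neg, ← LinearMap.comp_apply, ← LinearMap.lTensor_comp,
    hexact.linearMap_comp_eq_zero]
  simp

lemma TorIndep.of_equiv (e : X ≃ₗ[A] Y) (h : TorIndep A X N) : TorIndep A Y N :=
  TorIndep.middle (f := e.toLinearMap) (g := (0 : Y →ₗ[A] PUnit.{u + 1}))
    (fun _ ↦ ⟨0, rfl⟩) (fun y ↦ by simp) e.injective h
    (torIndep_of_flat _ _)

end TorIndep

section TensorDepth

variable {A : Type u} [CommRing A] [IsLocalRing A]
  {X F Z N : Type u} [AddCommGroup X] [Module A X] [AddCommGroup F] [Module A F]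
  [AddCommGroup Z] [Module A Z] [AddCommGroup N] [Module A N]

lemma ExtVanishes.tensor_of_free [Module.Free A F] [Module.Finite A F] {i : ℕ}
    (h : ExtVanishes A N i) : ExtVanishes A (TensorProduct A F N) i := by
  let b := Module.Free.chooseBasis A F
  refine h.of_id_eq_sum (s := Finset.univ) (f := fun j ↦ TensorProduct.mk A F N (b j))
    (g := fun j ↦ (TensorProduct.lid A N).toLinearMap ∘ₗ LinearMap.rTensor N (b.coord j)) ?_
  ext x n
  simp only [TensorProduct.AlgebraTensorModule.curry_apply, LinearMap.restrictScalars_self,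
    TensorProduct.curry_apply, LinearMap.sum_apply, LinearMap.comp_apply,
    LinearMap.rTensor_tmul, LinearEquiv.coe_coe, TensorProduct.lid_tmul, TensorProduct.mk_apply,
    LinearMap.id_apply, ← TensorProduct.smul_tmul, ← TensorProduct.sum_tmul]
  congr 1
  exact b.sum_repr x

lemma ExtVanishes.of_tensor_free [Module.Free A F] [Nontrivial F] {i : ℕ}
    (h : ExtVanishes A (TensorProduct A F N) i) : ExtVanishes A N i := by
  let b := Module.Free.chooseBasis A F
  obtain ⟨j⟩ := b.index_nonempty
  refine h.of_comp_eq_id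
    (f := (TensorProduct.lid A N).toLinearMap ∘ₗ LinearMap.rTensor N (b.coord j))
    (g := TensorProduct.mk A F N (b j)) ?_
  ext n
  simp

lemma HasExtDepth.tensor_free [Module.Free A F] [Module.Finite A F] [Nontrivial F] {n : ℕ}
    (h : HasExtDepth A N n) : HasExtDepth A (TensorProduct A F N) n :=
  ⟨fun i hi ↦ (h.1 i hi).tensor_of_free, fun h' ↦ h.2 h'.of_tensor_free⟩

/-- A map of finite free modules with image in `𝔪F` induces zero on `Ext(k, - ⊗ N)`. -/
lemma residueExtMap_rTensor_eq_zero [Module.Free A X] [Module.Finite A X]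
    [Module.Free A F] [Module.Finite A F] (f : X →ₗ[A] F)
    (hf : ∀ x, f x ∈ maximalIdeal A • (⊤ : Submodule A F)) {i : ℕ}
    (x : Abelian.Ext (ModuleCat.of A (A ⧸ maximalIdeal A))
      (ModuleCat.of A (TensorProduct A X N)) i) :
    residueExtMap x (LinearMap.rTensor N f) = 0 := by
  let b := Module.Free.chooseBasis A X
  let c := Module.Free.chooseBasis A F
  have hcoord (j l) : c.coord l (f (b j)) ∈ maximalIdeal A := by
    have : c.coord l (f (b j)) ∈ (maximalIdeal A • (⊤ : Submodule A F)).map (c.coord l) :=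
      Submodule.mem_map_of_mem (hf _)
    rw [Submodule.map_smul'', smul_eq_mul] at this
    exact Ideal.mul_le_left this
  have hsum : f = ∑ j, ∑ l, c.coord l (f (b j)) • (b.coord j).smulRight (c l) := by
    refine b.ext fun j ↦ ?_
    simp only [LinearMap.sum_apply, LinearMap.smul_apply, LinearMap.smulRight_apply,
      Module.Basis.coord_apply, Module.Basis.repr_self]
    rw [Finset.sum_eq_single j (fun j' _ hj ↦ by simp [hj.symm]) (by simp)]
    simp
  have hr : LinearMap.rTensor N f = ∑ j, ∑ l, c.coord l (f (b j)) •
      LinearMap.rTensor N ((b.coord j).smulRight (c l)) := by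
    refine TensorProduct.ext' fun y n ↦ ?_
    have hy : f y = ∑ j, ∑ l, c.coord l (f (b j)) • b.coord j y • c l := by
      conv_lhs => rw [hsum]
      simp only [LinearMap.sum_apply, LinearMap.smul_apply, LinearMap.smulRight_apply]
    simp only [LinearMap.rTensor_tmul, LinearMap.sum_apply, LinearMap.smul_apply, hy,
      LinearMap.smulRight_apply, TensorProduct.sum_tmul, TensorProduct.smul_tmul']
  rw [hr, map_sum]
  refine Finset.sum_eq_zero fun j _ ↦ ?_
  rw [map_sum]
  exact Finset.sum_eq_zero fun l _ ↦ residueExtMap_smul_of_mem x (hcoord j l) _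

/-- Over a local ring, a finite module is the image of a finite free module by a map whose
kernel lies in `𝔪F`. -/
lemma exists_minimal_free_cover (M : Type u) [AddCommGroup M] [Module A M] [Module.Finite A M] :
    ∃ (n : ℕ) (p : (Fin n → A) →ₗ[A] M), Function.Surjective p ∧
      ∀ x ∈ LinearMap.ker p, x ∈ maximalIdeal A • (⊤ : Submodule A (Fin n → A)) := by
  let w := Module.finBasis (ResidueField A) (TensorProduct A (ResidueField A) M)
  obtain ⟨v, hv⟩ := (TensorProduct.mk_surjective A M (ResidueField A)
    Ideal.Quotient.mk_surjective).comp_left w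
  refine ⟨_, Fintype.linearCombination A v, ?_, fun x hx ↦ ?_⟩
  · rw [← LinearMap.range_eq_top, Fintype.range_linearCombination]
    exact span_eq_top_of_tmul_eq_basis v w (congr_fun hv)
  · have hres (j) : x j ∈ maximalIdeal A := by
      rw [← IsLocalRing.residue_eq_zero_iff]
      refine Fintype.linearIndependent_iff.mp w.linearIndependent (fun j ↦ residue A (x j)) ?_ j
      have hx' : TensorProduct.mk A (ResidueField A) M 1 (Fintype.linearCombination A v x) = 0 := by
        rw [LinearMap.mem_ker.mp hx, map_zero]
      rw [Fintype.linearCombination_apply, map_sum] at hx'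
      rw [← hx']
      refine Finset.sum_congr rfl fun j _ ↦ ?_
      rw [map_smul, ← congr_fun hv j]
      exact algebraMap_smul (ResidueField A) (x j) _
    rw [← Module.Basis.sum_repr (Pi.basisFun A (Fin _)) x]
    exact Submodule.sum_mem _ fun j _ ↦ Submodule.smul_mem_smul (by simpa using hres j) trivial

omit [IsLocalRing A] in
/-- Tensoring a short exact sequence with a module Tor-independent of its last term. -/
lemma TorIndep.tensor_shortExact {f : X →ₗ[A] F} {g : F →ₗ[A] Z} (hg : Function.Surjective g)
    (h : Function.Exact f g) (hf : Function.Injective f) (hZ : TorIndep A Z N) :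
    Function.Injective (LinearMap.rTensor N f) ∧ Function.Surjective (LinearMap.rTensor N g) ∧
      Function.Exact (LinearMap.rTensor N f) (LinearMap.rTensor N g) :=
  ⟨hZ.rTensor_injective hg h hf, LinearMap.rTensor_surjective _ hg, rTensor_exact _ h hg⟩

lemma exists_surjective_residueField (M : Type u) [AddCommGroup M] [Module A M]
    [Module.Finite A M] [Nontrivial M] :
    ∃ f : M →ₗ[A] A ⧸ maximalIdeal A, Function.Surjective f := by
  obtain ⟨I, f, hI, hf⟩ := Module.exists_surjective_quotient_of_finite A M
  have h := le_maximalIdeal hI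
  exact ⟨Submodule.factor h ∘ₗ f, (Submodule.factor_surjective h).comp hf⟩

lemma nontrivial_tensorProduct (M N : Type u) [AddCommGroup M] [Module A M] [AddCommGroup N]
    [Module A N] [Module.Finite A M] [Module.Finite A N] [Nontrivial M] [Nontrivial N] :
    Nontrivial (TensorProduct A M N) := by
  obtain ⟨f, hf⟩ := exists_surjective_residueField (A := A) M
  obtain ⟨g, hg⟩ := exists_surjective_residueField (A := A) N
  have hsurj : Function.Surjective
      (LinearMap.mul' A (A ⧸ maximalIdeal A) ∘ₗ TensorProduct.map f g) := by
    intro x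
    obtain ⟨x, rfl⟩ := hf x
    obtain ⟨y, hy⟩ := hg 1
    exact ⟨x ⊗ₜ[A] y, by simp [hy]⟩
  exact hsurj.nontrivial

end TensorDepth

section FiniteProjDim

variable {A : Type u} [CommRing A] [IsLocalRing A] [IsNoetherianRing A]

lemma HasFiniteProjDim.exists_hasProjectiveDimensionLT {A : Type u} [CommRing A] {M : Type u}
    [AddCommGroup M] [Module A M] (h : HasFiniteProjDim A M) :
    ∃ n, HasProjectiveDimensionLT (ModuleCat.of A M) (n + 1) := by
  obtain ⟨R, hR⟩ := h
  have hproj (n) (j) : HasProjectiveDimensionLT (R.G n) (j + 1) := by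
    have : Projective (R.G n) := (IsProjective.iff_projective _).mp (hR n)
    infer_instance
  have hrange (k n : ℕ) (hk : R.len ≤ n + k) :
      HasProjectiveDimensionLT (ModuleCat.of A (LinearMap.range (R.d n))) (k + 1) := by
    induction k generalizing n with
    | zero =>
      have hsub : Subsingleton (R.G (n + 1)) := R.bounded _ (by omega)
      have : Subsingleton (LinearMap.range (R.d n)) :=
        (LinearMap.surjective_rangeRestrict (R.d n)).subsingleton
      have : Limits.IsZero (ModuleCat.of A (LinearMap.range (R.d n))) :=
        ModuleCat.isZero_of_subsingleton _
      have := this.hasProjectiveDimensionLT_zero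
      exact hasProjectiveDimensionLT_of_ge _ 0 1 (by omega)
    | succ k ih =>
      refine (exactShortComplex_shortExact (f := (LinearMap.range (R.d (n + 1))).subtype)
        (g := (R.d n).rangeRestrict) (Submodule.subtype_injective _)
        (LinearMap.surjective_rangeRestrict _) ?_).hasProjectiveDimensionLT_X₃ (k + 1)
        (ih (n + 1) (by omega)) (hproj _ _)
      rw [LinearMap.exact_iff, LinearMap.ker_rangeRestrict, Submodule.range_subtype]
      exact (R.exact_d n).linearMap_ker_eq
  refine ⟨R.len + 1, (exactShortComplex_shortExact (f := (LinearMap.range (R.d 0)).subtype)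
    (g := R.aug) (Submodule.subtype_injective _) R.aug_surj ?_).hasProjectiveDimensionLT_X₃ _
    (hrange R.len 0 (by omega)) (hproj _ _)⟩
  rw [LinearMap.exact_iff, Submodule.range_subtype]
  exact R.exact_aug.linearMap_ker_eq

/-- A nonzero finite module `M` of finite projective dimension `p` lowers the depth of every
Tor-independent nonzero finite module by `p` upon tensoring. -/
lemma exists_depth_drop_of_hasProjectiveDimensionLT (n : ℕ) (M : Type u) [AddCommGroup M]
    [Module A M] [Module.Finite A M] [Nontrivial M]
    (hpd : HasProjectiveDimensionLT (ModuleCat.of A M) (n + 1)) :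
    ∃ p : ℕ, (p = 0 → Module.Free A M) ∧
      ∀ (N : Type u) [AddCommGroup N] [Module A N], TorIndep A M N →
        ∀ s, HasExtDepth A N s → ∃ r, r + p = s ∧ HasExtDepth A (TensorProduct A M N) r := by
  induction n generalizing M with
  | zero =>
    have : Projective (ModuleCat.of A M) := inferInstance
    have : Module.Projective A M := (IsProjective.iff_projective M).mpr this
    have : Module.Free A M := Module.free_of_flat_of_isLocalRing
    exact ⟨0, fun _ ↦ this, fun N _ _ _ s hs ↦ ⟨s, rfl, hs.tensor_free⟩⟩
  | succ n ih =>
    by_cases hfree : Module.Free A M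
    · exact ⟨0, fun _ ↦ hfree, fun N _ _ _ s hs ↦ ⟨s, rfl, hs.tensor_free⟩⟩
    obtain ⟨k, π, hπ, hmin⟩ := exists_minimal_free_cover (A := A) M
    let ι := (LinearMap.ker π).subtype
    have hι : Function.Injective ι := Submodule.subtype_injective _
    have hex : Function.Exact ι π := LinearMap.exact_subtype_ker_map π
    have : Nontrivial (LinearMap.ker π) := by
      rw [Submodule.nontrivial_iff_ne_bot]
      intro hbot
      exact hfree (Module.Free.of_equiv
        (LinearEquiv.ofBijective π ⟨LinearMap.ker_eq_bot.mp hbot, hπ⟩))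
    have hproj : Projective (ModuleCat.of A (Fin k → A)) :=
      (IsProjective.iff_projective (Fin k → A)).mp inferInstance
    have hker := (exactShortComplex_shortExact hι hπ hex).hasProjectiveDimensionLT_X₁ (n + 1)
      (inferInstanceAs (HasProjectiveDimensionLT (ModuleCat.of A (Fin k → A)) (n + 1))) hpd
    obtain ⟨p, hp0, hp⟩ := ih (LinearMap.ker π) hker
    refine ⟨p + 1, by omega, fun N _ _ hT s hs ↦ ?_⟩
    obtain ⟨r', hr', hdepth⟩ := hp N (TorIndep.left hπ hex hι (torIndep_of_flat _ _) hT) s hs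
    obtain ⟨hi, hsur, hexact⟩ := hT.tensor_shortExact hπ hex hι
    have hlow (i) (hi' : i + 1 < r') : ExtVanishes A (TensorProduct A M N) i :=
      (hdepth.1 _ hi').right hi hsur hexact (hs.1 i (by omega)).tensor_of_free
    obtain rfl | hp1 := Nat.eq_zero_or_pos p
    · have := hp0 rfl
      have hzero {i : ℕ} (x : Abelian.Ext (ModuleCat.of A (A ⧸ maximalIdeal A))
          (ModuleCat.of A (TensorProduct A (LinearMap.ker π) N)) i) :
          residueExtMap x (LinearMap.rTensor N ι) = 0 :=
        residueExtMap_rTensor_eq_zero ι (fun x ↦ hmin _ x.2) x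
      obtain _ | r := r'
      · exact absurd (ExtVanishes.zero_of_map_eq_zero hi hzero) hdepth.2
      · exact ⟨r, by omega, fun i hir ↦ hlow i (by omega), fun hv ↦
          hdepth.2 (ExtVanishes.left_of_map_eq_zero hi hsur hexact hzero hv)⟩
    · obtain _ | r := r'
      · exact absurd (ExtVanishes.zero_of_injective hi (hs.1 0 (by omega)).tensor_of_free)
          hdepth.2
      · exact ⟨r, by omega, fun i hir ↦ hlow i (by omega), fun hv ↦
          hdepth.2 (ExtVanishes.left hi hsur hexact (hs.1 _ (by omega)).tensor_of_free hv)⟩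

end FiniteProjDim

section Syzygy

variable {A : Type u} [CommRing A] [IsLocalRing A]
  {M N : Type u} [AddCommGroup M] [Module A M] [AddCommGroup N] [Module A N]

/-- Properties passing from `M` to its syzygies: finiteness, Tor-independence of `N`, and
the lower depth bound after tensoring with `N`. -/
lemma syzygy_step [IsNoetherianRing A] {F X Z : Type u} [AddCommGroup F] [Module A F]
    [AddCommGroup X]
    [Module A X] [AddCommGroup Z] [Module A Z] [Module.Free A F] [Module.Finite A F]
    {f : X →ₗ[A] F} {g : F →ₗ[A] Z} (hf : Function.Injective f) (hg : Function.Surjective g)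
    (h : Function.Exact f g) (hT : TorIndep A Z N) :
    Module.Finite A X ∧ TorIndep A X N ∧ ∀ n, (∀ i < n, ExtVanishes A (TensorProduct A Z N) i) →
      (∀ i < n, ExtVanishes A N i) → ∀ i < n, ExtVanishes A (TensorProduct A X N) i := by
  refine ⟨Module.Finite.of_injective f hf, TorIndep.left hg h hf (torIndep_of_flat _ _) hT,
    fun n hZ hN i hi ↦ ?_⟩
  obtain ⟨hinj, hsur, hexact⟩ := hT.tensor_shortExact hg h hf
  obtain _ | i := i
  · exact ExtVanishes.zero_of_injective hinj (hN 0 hi).tensor_of_free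
  · exact ExtVanishes.left hinj hsur hexact (hN _ hi).tensor_of_free (hZ i (by omega))

lemma IsSyzygy.tensor_depth [IsNoetherianRing A] [Module.Finite A M] {S : Type u}
    [AddCommGroup S] [Module A S] {t : ℕ} (h : IsSyzygy A M S t) (hT : TorIndep A M N) :
    Module.Finite A S ∧ TorIndep A S N ∧ ∀ n, (∀ i < n, ExtVanishes A (TensorProduct A M N) i) →
      (∀ i < n, ExtVanishes A N i) → ∀ i < n, ExtVanishes A (TensorProduct A S N) i := by
  obtain _ | t := t
  · obtain ⟨e⟩ := h
    exact ⟨Module.Finite.equiv e.symm, hT.of_equiv e.symm,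
      fun n hM _ i hi ↦ (hM i hi).of_equiv (LinearEquiv.rTensor N e.symm)⟩
  · obtain ⟨R, ⟨e⟩⟩ := h
    have := R.free
    have := R.fin
    suffices H : Module.Finite A (LinearMap.range (R.d t)) ∧
        TorIndep A (LinearMap.range (R.d t)) N ∧
        ∀ n, (∀ i < n, ExtVanishes A (TensorProduct A M N) i) → (∀ i < n, ExtVanishes A N i) →
          ∀ i < n, ExtVanishes A (TensorProduct A (LinearMap.range (R.d t)) N) i by
      obtain ⟨h1, h2, h3⟩ := H
      exact ⟨Module.Finite.equiv e.symm, h2.of_equiv e.symm,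
        fun n hM hN i hi ↦ (h3 n hM hN i hi).of_equiv (LinearEquiv.rTensor N e.symm)⟩
    clear e
    induction t with
    | zero =>
      refine syzygy_step (f := (LinearMap.range (R.d 0)).subtype) (g := R.aug)
        (Submodule.subtype_injective _) R.aug_surj ?_ hT
      rw [LinearMap.exact_iff, Submodule.range_subtype]
      exact R.exact_aug.linearMap_ker_eq
    | succ t ih =>
      obtain ⟨_, h2, h3⟩ := ih
      obtain ⟨k1, k2, k3⟩ := syzygy_step (f := (LinearMap.range (R.d (t + 1))).subtype)
        (g := (R.d t).rangeRestrict) (Submodule.subtype_injective _)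
        (LinearMap.surjective_rangeRestrict _) (by
          rw [LinearMap.exact_iff, LinearMap.ker_rangeRestrict, Submodule.range_subtype]
          exact (R.exact_d t).linearMap_ker_eq) h2
      exact ⟨k1, k2, fun n hM hN ↦ k3 n (h3 n hM hN) hN⟩

/-- In a short exact sequence `0 → X → Y → Z → 0` with `depth X ≤ depth Z`, the depths of
`X` and `Y` agree. -/
lemma HasExtDepth.middle {X Y Z : Type u} [AddCommGroup X] [Module A X] [AddCommGroup Y]
    [Module A Y] [AddCommGroup Z] [Module A Z] {f : X →ₗ[A] Y} {g : Y →ₗ[A] Z}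
    (hf : Function.Injective f) (hg : Function.Surjective g) (h : Function.Exact f g) {n : ℕ}
    (hX : HasExtDepth A X n) (hZ : ∀ i < n, ExtVanishes A Z i) : HasExtDepth A Y n := by
  refine ⟨fun i hi ↦ ExtVanishes.middle hf hg h (hX.1 i hi) (hZ i hi), fun hv ↦ hX.2 ?_⟩
  obtain _ | n := n
  · exact ExtVanishes.zero_of_injective hf hv
  · exact ExtVanishes.left hf hg h hv (hZ n (by omega))

end Syzygy

/-- The depth formula in terms of `Ext(k, -)`, for modules of depth less than `depth A`. -/
lemma HasRedCxCat.depth_formula {A : Type u} [CommRing A] [IsLocalRing A] [IsNoetherianRing A]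
    {N : Type u} [AddCommGroup N] [Module A N] [Module.Finite A N] [Nontrivial N]
    {d s : ℕ} (hA : HasExtDepth A A d) (hN : HasExtDepth A N s)
    {M : ModuleCat.{u} A} (hred : HasRedCxCat A M) :
    ∀ [Module.Finite A M] [Nontrivial M], TorIndep A M N → ∀ {m r : ℕ}, m < d →
      HasExtDepth A M m → HasExtDepth A (TensorProduct A M N) r → m + s = d + r := by
  induction hred with
  | of_finite_pd M h =>
    intro _ _ hT m r _ hM hMN
    obtain ⟨n, hn⟩ := h.exists_hasProjectiveDimensionLT
    obtain ⟨p, -, hp⟩ := exists_depth_drop_of_hasProjectiveDimensionLT n M hn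
    obtain ⟨m', hm', hM'⟩ := hp A (torIndep_of_projective_right _ _) d hA
    obtain ⟨r', hr', hMN'⟩ := hp N hT s hN
    have h1 := hM.unique (hM'.of_equiv (TensorProduct.rid A M))
    have h2 := hMN.unique hMN'
    omega
  | of_step M K t _ _ hKM _ _ ih =>
    intro _ _ hT m r hmd hM hMN
    obtain ⟨-, S, _, _, hS, f, g, hf, hg, hfg⟩ := hKM
    obtain ⟨_, hST, hSN⟩ := hS.tensor_depth hT
    obtain ⟨-, -, hSA⟩ := hS.tensor_depth (torIndep_of_projective_right M A)
    have : Module.Finite A K := Module.Finite.of_exact hfg hg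
    have : Nontrivial K := hf.nontrivial
    have hSm : ∀ i < m, ExtVanishes A S i := fun i hi ↦
      (hSA m (fun i hi ↦ (hM.1 i hi).of_equiv (TensorProduct.rid A M).symm)
        (fun i hi ↦ hA.1 i (hi.trans hmd)) i hi).of_equiv (TensorProduct.rid A S)
    have hK : HasExtDepth A K m := hM.middle hf hg hfg hSm
    have hKT : TorIndep A K N := hT.middle hg hfg hf hST
    have := nontrivial_tensorProduct (A := A) K N
    obtain ⟨r', -, hKN, -⟩ := exists_moduleDepth_eq (A := A) (TensorProduct A K N)
    have hform := ih hKT hmd hK hKN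
    obtain ⟨hi, hsur, hexact⟩ := hST.tensor_shortExact hg hfg hf
    have hrs : r < s := by
      by_contra! hsr
      have := hKN.le_of_forall_lt (m := s) fun i his ↦ ExtVanishes.middle hi hsur hexact
        (hMN.1 i (his.trans_le hsr)) (hSN s (fun j hj ↦ hMN.1 j (hj.trans_le hsr)) hN.1 i his)
      omega
    have := hKN.unique (hMN.middle hi hsur hexact
      (hSN r hMN.1 fun i hir ↦ hN.1 i (hir.trans hrs)))
    omega

/-- **Depth formula - Cohen-Macaulay case 1 (Theorem 3.5).** Let `A` be a Cohen-Macaulay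
local ring and `M`, `N` nonzero finitely generated Tor-independent `A`-modules. If `M`
has reducible complexity and is not maximal Cohen-Macaulay, then
`depth M + depth N = dim A + depth (M ⊗ N)`. -/
theorem depth_formula_cohen_macaulay_case_one (A : Type u) [CommRing A] [IsNoetherianRing A]
    [IsLocalRing A] (hCM : IsCMLocalRing A)
    (M N : Type u) [AddCommGroup M] [Module A M] [AddCommGroup N] [Module A N]
    [Module.Finite A M] [Module.Finite A N]
    (hM : Nontrivial M) (hN : Nontrivial N)
    (hTor : TorIndep A M N)
    (hred : HasReducibleComplexity A M)
    (hnMCM : ¬ IsMaxCM A M) :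
    (moduleDepth A M : WithBot ℕ∞) + (moduleDepth A N : WithBot ℕ∞) =
      ringKrullDimE A + (moduleDepth A (TensorProduct A M N) : WithBot ℕ∞) := by
  obtain ⟨d, hd, hAd, -⟩ := exists_moduleDepth_eq (A := A) A
  obtain ⟨m, hm, hMm, hmdim⟩ := exists_moduleDepth_eq (A := A) M
  obtain ⟨s, hs, hNs, -⟩ := exists_moduleDepth_eq (A := A) N
  have := nontrivial_tensorProduct (A := A) M N
  obtain ⟨r, hr, hMNr, -⟩ := exists_moduleDepth_eq (A := A) (TensorProduct A M N)
  have hdim : ringKrullDim A = (d : WithBot ℕ∞) := by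
    rw [IsCMLocalRing, hd] at hCM
    exact hCM.symm
  have hmd : m < d := by
    rw [hdim] at hmdim
    refine lt_of_le_of_ne (by exact_mod_cast hmdim) fun h ↦ hnMCM ?_
    rw [IsMaxCM, hm, ringKrullDimE, hdim, h]
    rfl
  have key := HasRedCxCat.depth_formula hAd hNs hred hTor hmd hMm hMNr
  rw [hm, hs, hr, ringKrullDimE, hdim]
  exact_mod_cast congrArg (Nat.cast : ℕ → WithBot ℕ∞) key
end
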